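/- Every term of the star combinatory calculus is strongly normalizable: there is no infinite chain of one-step reductions starting from any term. -/

import Mathlib

namespace StarCalc

/-- Finite types over a single ground type `G`, closed under `→` and `*`. -/
inductive Ty : Type where
  | ground : Ty
  | arrow : Ty → Ty → Ty
  | star : Ty → Ty
deriving DecidableEq, Repr

/-- The type `G → ⋯ → G → G` with `n` arrows, the type of an `n`-ary function symbol. -/
def fnTy : ℕ → Ty
  | 0 => .ground
  | n + 1 => .arrow .ground (fnTy n)

/-- Terms of the star combinatory calculus over a family `F` of function symbols
(`F n` = the `n`-ary function symbols of the underlying first-order language). -/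
inductive Term (F : ℕ → Type) : Ty → Type where
  | var (n : ℕ) (σ : Ty) : Term F σ
  | fn {n : ℕ} (f : F n) : Term F (fnTy n)
  | pi (σ τ : Ty) : Term F (σ.arrow (τ.arrow σ))
  | sigma (ρ σ τ : Ty) :
      Term F ((ρ.arrow (σ.arrow τ)).arrow ((ρ.arrow σ).arrow (ρ.arrow τ)))
  | sing (σ : Ty) : Term F (σ.arrow σ.star)
  | union (σ : Ty) : Term F (σ.star.arrow (σ.star.arrow σ.star))
  | bigUnion (σ τ : Ty) : Term F (σ.star.arrow ((σ.arrow τ.star).arrow τ.star))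
  | app {σ τ : Ty} (t : Term F (σ.arrow τ)) (q : Term F σ) : Term F τ

variable {F : ℕ → Type}

/-- One-step reduction: apply one of the conversions
`Σtqr ⇝ tr(qr)`, `Πtq ⇝ t`, `⋃(𝔰t)q ⇝ qt`, `⋃(∪tq)r ⇝ ∪(⋃tr)(⋃qr)`
to a subterm. -/
inductive Step : {σ : Ty} → Term F σ → Term F σ → Prop where
  | sigma {ρ σ τ : Ty} (t : Term F (ρ.arrow (σ.arrow τ))) (q : Term F (ρ.arrow σ))
      (r : Term F ρ) :
      Step ((((Term.sigma ρ σ τ).app t).app q).app r) ((t.app r).app (q.app r))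
  | pi {σ τ : Ty} (t : Term F σ) (q : Term F τ) :
      Step (((Term.pi σ τ).app t).app q) t
  | bigUnion_sing {σ τ : Ty} (t : Term F σ) (q : Term F (σ.arrow τ.star)) :
      Step (((Term.bigUnion σ τ).app ((Term.sing σ).app t)).app q) (q.app t)
  | bigUnion_union {σ τ : Ty} (t q : Term F σ.star) (r : Term F (σ.arrow τ.star)) :
      Step (((Term.bigUnion σ τ).app (((Term.union σ).app t).app q)).app r)
        (((Term.union τ).app (((Term.bigUnion σ τ).app t).app r)).app
          (((Term.bigUnion σ τ).app q).app r))
  | app_left {σ τ : Ty} {t t' : Term F (σ.arrow τ)} (q : Term F σ) :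
      Step t t' → Step (t.app q) (t'.app q)
  | app_right {σ τ : Ty} (t : Term F (σ.arrow τ)) {q q' : Term F σ} :
      Step q q' → Step (t.app q) (t.app q')

/-- `t ⪰ q` : `t` reduces to `q` by finitely many (possibly zero) one-step reductions. -/
def Reduces {σ : Ty} (t q : Term F σ) : Prop :=
  Relation.ReflTransGen Step t q

/-- A term is normal if no one-step reduction applies to it. -/
def Normal {σ : Ty} (t : Term F σ) : Prop :=
  ∀ q : Term F σ, ¬ Step t q

/-- A term is strongly normalizable if there is no infinite chain of one-step
reductions starting from it. -/
def SN {σ : Ty} (t : Term F σ) : Prop :=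
  ¬ ∃ f : ℕ → Term F σ, f 0 = t ∧ ∀ n : ℕ, Step (f n) (f (n + 1))

/-- A term is closed if it contains no variables. -/
def Term.ClosedT : {σ : Ty} → Term F σ → Prop
  | _, .var _ _ => False
  | _, .app t q => t.ClosedT ∧ q.ClosedT
  | _, _ => True

end StarCalc

namespace StarCalc

variable {F : ℕ → Type}

/-- The number of further arguments the term must receive before it becomes inert:
`0` exactly for terms whose application to an argument is never itself a conversion redex
and which are not of the form `𝔰t` or `∪tq`. -/
def Term.need : {σ : Ty} → Term F σ → ℕ
  | _, .var _ _ => 0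
  | _, .fn _ => 0
  | _, .pi _ _ => 2
  | _, .sigma _ _ _ => 3
  | _, .sing _ => 2
  | _, .union _ => 3
  | _, .bigUnion _ _ => 2
  | _, .app t _ => t.need - 1

/-- The term is an application. -/
def Term.IsApp : {σ : Ty} → Term F σ → Prop
  | _, .app _ _ => True
  | _, _ => False

theorem Step.isApp {σ : Ty} {t s : Term F σ} (h : Step t s) : t.IsApp := by
  cases h <;> trivial

theorem Step.app_cases {σ τ : Ty} {t : Term F (σ.arrow τ)} {q : Term F σ} {s : Term F τ}
    (h : Step (t.app q) s) (ht : t.need = 0) :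
    (∃ t', Step t t' ∧ s = t'.app q) ∨ ∃ q', Step q q' ∧ s = t.app q' := by
  cases h with
  | sigma => simp [Term.need] at ht
  | pi => simp [Term.need] at ht
  | bigUnion_sing => simp [Term.need] at ht
  | bigUnion_union => simp [Term.need] at ht
  | app_left _ h => exact .inl ⟨_, h, rfl⟩
  | app_right _ h => exact .inr ⟨_, h, rfl⟩

/-- Accessibility for one-step reduction, i.e. inductive strong normalizability. -/
abbrev AccStep {σ : Ty} (t : Term F σ) : Prop := Acc (fun a b : Term F σ => Step b a) t

theorem AccStep.sn {σ : Ty} {t : Term F σ} (h : AccStep t) : SN t := by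
  induction h with
  | intro t _ ih =>
    rintro ⟨f, rfl, hf⟩
    exact ih (f 1) (hf 0) ⟨fun n => f (n + 1), rfl, fun n => hf (n + 1)⟩

/-- Reducibility at type `σ*` relative to a predicate at type `σ`. -/
inductive StarRed {σ : Ty} (P : Term F σ → Prop) : Term F σ.star → Prop where
  | intro (t : Term F σ.star)
      (step : ∀ t', Step t t' → StarRed P t')
      (sing : ∀ u, t = (Term.sing σ).app u → P u)
      (left : ∀ a b, t = ((Term.union σ).app a).app b → StarRed P a)
      (right : ∀ a b, t = ((Term.union σ).app a).app b → StarRed P b) : StarRed P t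

/-- Tait reducibility. -/
def Red : (σ : Ty) → Term F σ → Prop
  | .ground, t => AccStep t
  | .arrow σ τ, t => ∀ q, Red σ q → Red τ (t.app q)
  | .star σ, t => StarRed (Red σ) t

theorem StarRed.accStep {σ : Ty} {P : Term F σ → Prop} {t : Term F σ.star}
    (h : StarRed P t) : AccStep t := by
  induction h with
  | intro t _ _ _ _ ih _ _ => exact ⟨t, ih⟩

theorem AccStep.of_app {σ τ : Ty} {t : Term F (σ.arrow τ)} {q : Term F σ}
    (h : AccStep (t.app q)) : AccStep t := by
  generalize hs : t.app q = s at h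
  induction h generalizing t with
  | intro s _ ih =>
    subst hs
    exact ⟨t, fun t' ht => ih _ (.app_left q ht) rfl⟩

theorem Red.properties (σ : Ty) :
    (∀ t : Term F σ, Red σ t → AccStep t) ∧
    (∀ t t' : Term F σ, Red σ t → Step t t' → Red σ t') ∧
    (∀ t : Term F σ, t.need = 0 → (∀ t', Step t t' → Red σ t') → Red σ t) := by
  induction σ with
  | ground => exact ⟨fun _ h => h, fun _ _ h hs => h.inv hs, fun t _ h => ⟨t, h⟩⟩
  | arrow σ τ ihσ ihτ =>
    refine ⟨fun t h => ?_, fun t t' h hs q hq => ihτ.2.1 _ _ (h q hq) (.app_left q hs),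
      fun t hn h q hq => ?_⟩
    · refine (ihτ.1 _ (h (.var 0 σ) (ihσ.2.2 _ rfl fun _ hs => hs.isApp.elim))).of_app
    · have hacc := ihσ.1 q hq
      induction hacc with
      | intro q _ ih =>
        refine ihτ.2.2 _ (by simp [Term.need, hn]) fun s hs => ?_
        rcases hs.app_cases hn with ⟨t', ht, rfl⟩ | ⟨q', hq', rfl⟩
        · exact h t' ht q hq
        · exact ih q' hq' (ihσ.2.1 _ _ hq hq')
  | star σ _ =>
    refine ⟨fun t h => h.accStep, fun t t' h hs => ?_, fun t hn h => ⟨t, h, ?_, ?_, ?_⟩⟩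
    · cases h with
      | intro _ step => exact step t' hs
    all_goals
      intros
      subst t
      simp [Term.need] at hn

theorem Red.accStep {σ : Ty} {t : Term F σ} (h : Red σ t) : AccStep t :=
  (Red.properties σ).1 t h

theorem Red.step {σ : Ty} {t t' : Term F σ} (h : Red σ t) (hs : Step t t') : Red σ t' :=
  (Red.properties σ).2.1 t t' h hs

theorem Red.of_need_eq_zero {σ : Ty} {t : Term F σ} (hn : t.need = 0)
    (h : ∀ t', Step t t' → Red σ t') : Red σ t :=
  (Red.properties σ).2.2 t hn h

theorem Red.pi (σ τ : Ty) : Red _ (Term.pi σ τ : Term F _) := by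
  intro t ht q hq
  have hta := ht.accStep
  induction hta generalizing q with
  | intro t _ iht =>
  have hqa := hq.accStep
  induction hqa with
  | intro q _ ihq =>
  refine .of_need_eq_zero rfl fun s hs => ?_
  cases hs with
  | pi => exact ht
  | app_left _ h =>
    cases h with
    | app_left _ h => exact h.isApp.elim
    | app_right _ h => exact iht _ h (ht.step h) q hq
  | app_right _ h => exact ihq _ h (hq.step h)

theorem Red.sigma (ρ σ τ : Ty) : Red _ (Term.sigma ρ σ τ : Term F _) := by
  intro t ht q hq r hr
  have hta := ht.accStep
  induction hta generalizing q r with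
  | intro t _ iht =>
  have hqa := hq.accStep
  induction hqa generalizing r with
  | intro q _ ihq =>
  have hra := hr.accStep
  induction hra with
  | intro r _ ihr =>
  refine .of_need_eq_zero rfl fun s hs => ?_
  cases hs with
  | sigma => exact ht r hr _ (hq r hr)
  | app_left _ h =>
    cases h with
    | app_left _ h =>
      cases h with
      | app_left _ h => exact h.isApp.elim
      | app_right _ h => exact iht _ h (ht.step h) q hq r hr
    | app_right _ h => exact ihq _ h (hq.step h) r hr
  | app_right _ h => exact ihr _ h (hr.step h)

theorem Red.sing (σ : Ty) : Red _ (Term.sing σ : Term F _) := by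
  intro t ht
  have hta := ht.accStep
  induction hta with
  | intro t _ ih =>
  refine ⟨_, fun s hs => ?_, fun u hu => ?_, fun a b h => ?_, fun a b h => ?_⟩
  · cases hs with
    | app_left _ h => exact h.isApp.elim
    | app_right _ h => exact ih _ h (ht.step h)
  · cases hu
    exact ht
  · cases h
  · cases h

theorem Red.union (σ : Ty) : Red _ (Term.union σ : Term F _) := by
  intro t ht q hq
  have hta := ht.accStep
  induction hta generalizing q with
  | intro t _ iht =>
  have hqa := hq.accStep
  induction hqa with
  | intro q _ ihq =>
  refine ⟨_, fun s hs => ?_, fun u hu => ?_, fun a b h => ?_, fun a b h => ?_⟩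
  · cases hs with
    | app_left _ h =>
      cases h with
      | app_left _ h => exact h.isApp.elim
      | app_right _ h => exact iht _ h (ht.step h) q hq
    | app_right _ h => exact ihq _ h (hq.step h)
  · cases hu
  · cases h
    exact ht
  · cases h
    exact hq

theorem Red.bigUnion (σ τ : Ty) : Red _ (Term.bigUnion σ τ : Term F _) := by
  intro t ht q hq
  change StarRed (Red σ) t at ht
  induction ht generalizing q with
  | intro t _ hsing _ _ iht ihl ihr =>
  have hqa := hq.accStep
  induction hqa with
  | intro q _ ihq =>
  refine .of_need_eq_zero rfl fun s hs => ?_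
  cases hs with
  | bigUnion_sing u => exact hq u (hsing u rfl)
  | bigUnion_union a b => exact Red.union τ _ (ihl a b rfl q hq) _ (ihr a b rfl q hq)
  | app_left _ h =>
    cases h with
    | app_left _ h => exact h.isApp.elim
    | app_right _ h => exact iht _ h q hq
  | app_right _ h => exact ihq _ h (hq.step h)

theorem Term.red {σ : Ty} (t : Term F σ) : Red σ t := by
  induction t with
  | var => exact .of_need_eq_zero rfl fun _ hs => hs.isApp.elim
  | fn => exact .of_need_eq_zero rfl fun _ hs => hs.isApp.elim
  | pi => exact .pi _ _
  | sigma => exact .sigma _ _ _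
  | sing => exact .sing _
  | union => exact .union _
  | bigUnion => exact .bigUnion _ _
  | app _ _ iht ihq => exact iht _ ihq

end StarCalc

open StarCalc in
/-- Every term of the star combinatory calculus is strongly
normalizable: there is no infinite chain of one-step reductions starting from any term. -/
theorem star_calculus_strong_normalization (F : ℕ → Type) (c : F 0)
    {σ : Ty} (t : Term F σ) : SN t := by
  exact t.red.accStep.sn
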